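/- Let G_ω be a weighted graph with goal vertex x. Then π(G_ω, x) = 1 + max{‖p‖ : p is a pebble distribution that is insufficient for x and squished on the thread of every unweighted open ear of G with respect to x} (the maximum exists since G is connected, so the sizes of insufficient distributions are bounded, and the zero distribution is insufficient and squished). -/

import Mathlib

open Finset

variable {V : Type*}

/-- Applying the pebbling move `m = (v, u)` on `G_ω`: remove `ω v u` pebbles at `v`
and add one pebble at `u`. -/
def moveFn [DecidableEq V] (ω : V → V → ℕ) (m : V × V) (p : V → ℤ) : V → ℤ :=
  fun w => if w = m.1 then p m.1 - ω m.1 m.2 else if w = m.2 then p m.2 + 1 else p w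

/-- The pebble function obtained after applying a sequence of pebbling moves. -/
def applyList [DecidableEq V] (ω : V → V → ℕ) : List (V × V) → (V → ℤ) → (V → ℤ)
  | [], p => p
  | m :: l, p => applyList ω l (moveFn ω m p)

/-- A pebbling sequence is executable from `p` if every move is along an edge of `G`
and every intermediate pebble function is nonnegative. -/
def Executable [DecidableEq V] (G : SimpleGraph V) (ω : V → V → ℕ) :
    (V → ℤ) → List (V × V) → Prop
  | _, [] => True
  | p, m :: l => G.Adj m.1 m.2 ∧ (∀ w, 0 ≤ moveFn ω m p w) ∧ Executable G ω (moveFn ω m p) l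

/-- `x` is `t`-reachable from `p` on the weighted graph `G_ω`. -/
def Reaches [DecidableEq V] (G : SimpleGraph V) (ω : V → V → ℕ) (p : V → ℤ) (x : V)
    (t : ℕ) : Prop :=
  ∃ l : List (V × V), Executable G ω p l ∧ (t : ℤ) ≤ applyList ω l p x

/-- A pebble distribution is a nonnegative pebble function. -/
def IsDistrib (p : V → ℤ) : Prop := ∀ v, 0 ≤ p v

/-- The size of a pebble distribution: the total number of pebbles. -/
def size [Fintype V] (p : V → ℤ) : ℤ := ∑ v, p v

/-- The `t`-pebbling number `π_t(G_ω, x)`: the least `m` such that `x` is `t`-reachable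
from every pebble distribution of size `m`. -/
noncomputable def piT [Fintype V] [DecidableEq V] (G : SimpleGraph V) (ω : V → V → ℕ)
    (x : V) (t : ℕ) : ℕ :=
  sInf {m : ℕ | ∀ p : V → ℤ, IsDistrib p → size p = (m : ℤ) → Reaches G ω p x t}

/-- `p_S` for a multiset `S` of pebbling moves:
`p_S(w) = p(w) + d⁻(w) − ∑ ω(w,u)` over arcs leaving `w`. -/
def applyMS [DecidableEq V] (ω : V → V → ℕ) (S : Multiset (V × V)) (p : V → ℤ) : V → ℤ :=
  fun w => p w + (Multiset.card (S.filter (fun m => m.2 = w)) : ℤ)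
    - ((S.filter (fun m => m.1 = w)).map (fun m => (ω m.1 m.2 : ℤ))).sum

/-- The transition digraph of `S` contains a directed cycle. -/
def HasCycle (S : Multiset (V × V)) : Prop :=
  ∃ l : List (V × V), l ≠ [] ∧ (l : Multiset (V × V)) ≤ S ∧
    List.Chain' (fun a b => a.2 = b.1) l ∧
    l.getLast?.map Prod.snd = l.head?.map Prod.fst

/-- A multiset of pebbling moves is acyclic if its transition digraph has no directed cycle. -/
def Acyclic (S : Multiset (V × V)) : Prop := ¬HasCycle S

/-- A list of pebbling moves is regular if each move is an initial move of the multiset of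
remaining moves: the source of each move has in-degree zero among the remaining moves. -/
def RegularSeq : List (V × V) → Prop
  | [] => True
  | m :: l => (∀ m' ∈ m :: l, m'.2 ≠ m.1) ∧ RegularSeq l

/-- `v` is a cut vertex of the (connected) graph `G`: deleting `v` disconnects `G`. -/
def IsCutVertex {V : Type*} (G : SimpleGraph V) (v : V) : Prop :=
  ¬(G.induce {w : V | w ≠ v}).Connected

/-- An ear of `G` with respect to the goal vertex `x`: a maximal thread of
inner vertices `w 1, …, w k` of degree `2`, none equal to `x`, together with the two end
vertices `w 0` and `w (k+1)` (which coincide for a closed ear). -/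
structure EarData {V : Type*} (G : SimpleGraph V) (x : V) where
  /-- the number of inner vertices -/
  k : ℕ
  kpos : 1 ≤ k
  /-- the consecutive vertices of the ear -/
  w : Fin (k + 2) → V
  adj : ∀ i : Fin (k + 1), G.Adj (w i.castSucc) (w i.succ)
  /-- inner vertices differ from the goal vertex -/
  notx : ∀ i : Fin (k + 2), i ≠ 0 → i ≠ Fin.last (k + 1) → w i ≠ x
  /-- inner vertices have degree 2: their neighbors are exactly their ear neighbors -/
  deg2 : ∀ i : Fin (k + 2), i ≠ 0 → i ≠ Fin.last (k + 1) →
    G.neighborSet (w i) = {w (i - 1), w (i + 1)}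
  /-- inner vertices are distinct from each other and from the ends -/
  inj : ∀ i j : Fin (k + 2), i ≠ 0 → i ≠ Fin.last (k + 1) → w i = w j → i = j
  /-- maximality of the thread at the first end -/
  max0 : w 0 = x ∨ ¬∃ a b : V, a ≠ b ∧ G.neighborSet (w 0) = {a, b}
  /-- maximality of the thread at the second end -/
  maxl : w (Fin.last (k + 1)) = x ∨
    ¬∃ a b : V, a ≠ b ∧ G.neighborSet (w (Fin.last (k + 1))) = {a, b}

variable {G : SimpleGraph V} {x : V}

/-- A closed ear: the two end vertices coincide. -/
def EarData.IsClosed (E : EarData G x) : Prop :=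
  E.w 0 = E.w (Fin.last (E.k + 1))

/-- A cut ear: all inner vertices are cut vertices of `G`. -/
def EarData.IsCutEar (E : EarData G x) : Prop :=
  ∀ i : Fin (E.k + 2), i ≠ 0 → i ≠ Fin.last (E.k + 1) → IsCutVertex G (E.w i)

/-- An open ear: an ear that is neither closed nor a cut ear. -/
def EarData.IsOpen (E : EarData G x) : Prop :=
  ¬E.IsClosed ∧ ¬E.IsCutEar

/-- An unweighted ear: all of its edges have weight `2`. -/
def EarData.Unweighted (E : EarData G x) (ω : V → V → ℕ) : Prop :=
  ∀ i : Fin (E.k + 1), ω (E.w i.castSucc) (E.w i.succ) = 2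

/-- `p` is squished on the thread of the ear `E`: all pebbles on the thread lie on a
single vertex or on two adjacent vertices of the thread. -/
def EarData.SquishedOn (E : EarData G x) (p : V → ℤ) : Prop :=
  ∃ j : Fin (E.k + 2), ∀ i : Fin (E.k + 2), i ≠ 0 → i ≠ Fin.last (E.k + 1) →
    0 < p (E.w i) → i = j ∨ (i : ℕ) = (j : ℕ) + 1

section Flow

/-- The pebble function obtained from `p` by making `f v u` moves from `v` to `u` for all
`v`, `u`, regardless of the order of the moves. -/
def balance [Fintype V] (ω : V → V → ℕ) (f : V → V → ℕ) (p : V → ℤ) (w : V) : ℤ :=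
  p w + ∑ a, (f a w : ℤ) - ∑ b, (f w b : ℤ) * ω w b

/-- The move counts `f` live on the edges of `G` and lead from `p` to a nonnegative pebble
function with a pebble on `x`. -/
structure Feasible [Fintype V] (G : SimpleGraph V) (ω : V → V → ℕ) (x : V)
    (p : V → ℤ) (f : V → V → ℕ) : Prop where
  adj : ∀ a b, f a b ≠ 0 → G.Adj a b
  nonneg : ∀ w, 0 ≤ balance ω f p w
  goal : 1 ≤ balance ω f p x

theorem moveFn_eq [DecidableEq V] {ω : V → V → ℕ} (p : V → ℤ) {v u : V} (h : v ≠ u) (w : V) :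
    moveFn ω (v, u) p w =
      p w + (if w = u then 1 else 0) - (if w = v then (ω v u : ℤ) else 0) := by
  unfold moveFn
  by_cases h1 : w = v
  · subst h1; simp [h]
  · by_cases h2 : w = u
    · subst h2; simp [h1]
    · simp [h1, h2]

variable [Fintype V] {ω : V → V → ℕ}

theorem balance_add (f g : V → V → ℕ) (p : V → ℤ) (w : V) :
    balance ω (fun a b => f a b + g a b) p w =
      balance ω f p w + ∑ a, (g a w : ℤ) - ∑ b, (g w b : ℤ) * ω w b := by
  simp only [balance, Nat.cast_add, add_mul, Finset.sum_add_distrib]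
  ring

/-- Opposite moves along an edge may be cancelled. -/
theorem Feasible.cancel (hω : ∀ u v : V, G.Adj u v → 2 ≤ ω u v) {p : V → ℤ}
    {f : V → V → ℕ} (h : Feasible G ω x p f) :
    Feasible G ω x p (fun a b => f a b - f b a) := by
  have hbal : ∀ w, balance ω f p w ≤ balance ω (fun a b => f a b - f b a) p w := by
    intro w
    have hfe : f = fun a b => (f a b - f b a) + min (f a b) (f b a) := by
      funext a b; omega
    conv_lhs => rw [hfe]
    rw [balance_add]
    have : ∑ a, ((min (f a w) (f w a) : ℕ) : ℤ) ≤
        ∑ b, ((min (f w b) (f b w) : ℕ) : ℤ) * ω w b := by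
      refine Finset.sum_le_sum fun a _ => ?_
      rw [min_comm]
      by_cases h0 : min (f w a) (f a w) = 0
      · simp [h0]
      · have h2 : (2 : ℤ) ≤ ω w a := by exact_mod_cast hω w a (h.adj w a (by omega))
        nlinarith [Int.natCast_nonneg (min (f w a) (f a w))]
    linarith
  exact ⟨fun a b hab => h.adj a b (by omega), fun w => (h.nonneg w).trans (hbal w),
    h.goal.trans (hbal x)⟩

theorem balance_mono_distrib {p q : V → ℤ} (f : V → V → ℕ) (w : V) (h : p w ≤ q w) :
    balance ω f p w ≤ balance ω f q w := by
  simp only [balance]; linarith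

variable [DecidableEq V]

theorem balance_add_single (f : V → V → ℕ) (p : V → ℤ) (v u : V) (c : ℕ) (w : V) :
    balance ω (fun a b => f a b + if a = v ∧ b = u then c else 0) p w =
      balance ω f p w + (if w = u then (c : ℤ) else 0)
        - (if w = v then (c : ℤ) * ω v u else 0) := by
  rw [balance_add]
  congr 1
  · congr 1
    by_cases h : w = u <;> simp [h]
  · by_cases h : w = v <;> simp [h]

theorem balance_add_move (f : V → V → ℕ) (p : V → ℤ) {v u : V} (h : v ≠ u) (w : V) :
    balance ω (fun a b => f a b + if a = v ∧ b = u then 1 else 0) p w =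
      balance ω f (moveFn ω (v, u) p) w := by
  rw [balance_add_single]
  simp only [balance, moveFn_eq p h, Nat.cast_one, one_mul]
  ring

theorem exists_flow_of_executable (l : List (V × V)) : ∀ p : V → ℤ, IsDistrib p →
    Executable G ω p l → ∃ f : V → V → ℕ, (∀ a b, f a b ≠ 0 → G.Adj a b) ∧
      ∀ w, 0 ≤ applyList ω l p w ∧ balance ω f p w = applyList ω l p w := by
  induction l with
  | nil =>
    intro p hp _
    exact ⟨fun _ _ => 0, by simp, fun w => ⟨hp w, by simp [balance, applyList]⟩⟩
  | cons m l ih =>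
    rintro p - ⟨hadj, hnn, hex⟩
    obtain ⟨f, hf, hb⟩ := ih _ hnn hex
    refine ⟨fun a b => f a b + if a = m.1 ∧ b = m.2 then 1 else 0, fun a b hab => ?_,
      fun w => ⟨(hb w).1, ?_⟩⟩
    · by_cases h : a = m.1 ∧ b = m.2
      · rw [h.1, h.2]; exact hadj
      · exact hf a b (by simpa [h] using hab)
    · rw [balance_add_move f p hadj.ne]
      exact (hb w).2

/-- If every source of a move has an incoming move then the move counts contain a subset of
moves that can be omitted without losing pebbles anywhere. -/
theorem exists_smaller_flow (hω : ∀ u v : V, G.Adj u v → 2 ≤ ω u v) {f : V → V → ℕ}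
    (hf : ∀ a b, f a b ≠ 0 → G.Adj a b) (hne : ∃ a b, f a b ≠ 0)
    (hin : ∀ a b, f a b ≠ 0 → ∃ c, f c a ≠ 0) (p : V → ℤ) :
    ∃ g : V → V → ℕ, (∀ a b, g a b ≤ f a b) ∧ (∑ a, ∑ b, g a b < ∑ a, ∑ b, f a b) ∧
      ∀ w, balance ω f p w ≤ balance ω g p w := by
  have hpred : ∀ a, ∃ c, (∃ b, f a b ≠ 0) → f c a ≠ 0 := by
    intro a
    by_cases h : ∃ b, f a b ≠ 0
    · obtain ⟨b, hb⟩ := h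
      obtain ⟨c, hc⟩ := hin a b hb
      exact ⟨c, fun _ => hc⟩
    · exact ⟨a, fun h' => absurd h' h⟩
  choose pred hpred using hpred
  let P : Finset V → Prop := fun B =>
    B.Nonempty ∧ (∀ v ∈ B, ∃ b, f v b ≠ 0) ∧ ∀ v ∈ B, pred v ∈ B
  have hP : ∃ B, P B := by
    classical
    refine ⟨univ.filter (fun v => ∃ b, f v b ≠ 0), ?_, ?_, ?_⟩
    · obtain ⟨a, b, h⟩ := hne
      exact ⟨a, by simpa using ⟨b, h⟩⟩
    · intro v hv; simpa using hv
    · intro v hv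
      have hv' : ∃ b, f v b ≠ 0 := by simpa using hv
      simpa using ⟨v, hpred v hv'⟩
  obtain ⟨B, ⟨hB0, hBs, hBp⟩, hmin⟩ := exists_minimal_of_wellFoundedLT P hP
  have himg : B.image pred ⊆ B := by
    intro v hv
    obtain ⟨a, ha, rfl⟩ := Finset.mem_image.1 hv
    exact hBp a ha
  have hsurj : B ⊆ B.image pred := by
    refine hmin ⟨hB0.image _, fun v hv => hBs v (himg hv), fun v hv => ?_⟩ himg
    exact Finset.mem_image_of_mem _ (himg hv)
  let c : V → V → ℕ := fun a b => if b ∈ B ∧ a = pred b then 1 else 0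
  have hcf : ∀ a b, c a b ≤ f a b := by
    intro a b
    by_cases h : b ∈ B ∧ a = pred b
    · have := hpred b (hBs b h.1)
      simp only [c, h, and_self, if_true]
      have h2 := h.2
      omega
    · simp [c, h]
  have hfe : f = fun a b => (f a b - c a b) + c a b := by
    funext a b
    have := hcf a b
    omega
  refine ⟨fun a b => f a b - c a b, fun a b => Nat.sub_le _ _, ?_, fun w => ?_⟩
  · obtain ⟨b, hb⟩ := hB0
    have hlt : f (pred b) b - c (pred b) b < f (pred b) b := by
      have := hpred b (hBs b hb)
      have h1 : c (pred b) b = 1 := by simp [c, hb]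
      omega
    refine Finset.sum_lt_sum (fun a _ => Finset.sum_le_sum fun b _ => Nat.sub_le _ _)
      ⟨pred b, mem_univ _, ?_⟩
    exact Finset.sum_lt_sum (fun b _ => Nat.sub_le _ _) ⟨b, mem_univ _, hlt⟩
  · conv_lhs => rw [hfe]
    rw [balance_add]
    by_cases hw : w ∈ B
    · have h1 : ∑ a, (c a w : ℤ) = 1 := by simp [c, hw]
      obtain ⟨b, hb, hbw⟩ := Finset.mem_image.1 (hsurj hw)
      have h2 : (c w b : ℤ) * ω w b ≤ ∑ b, (c w b : ℤ) * ω w b :=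
        Finset.single_le_sum (f := fun b => (c w b : ℤ) * ω w b)
          (fun _ _ => by positivity) (mem_univ b)
      have h3 : c w b = 1 := by simp [c, hb, hbw]
      have h4 : 2 ≤ ω w b := hω _ _ (hf _ _ (hbw ▸ hpred b (hBs b hb)))
      have h5 : (2 : ℤ) ≤ ω w b := by exact_mod_cast h4
      rw [h3, Nat.cast_one, one_mul] at h2
      linarith
    · have h1 : ∑ a, (c a w : ℤ) = 0 := by simp [c, hw]
      have h2 : 0 ≤ ∑ b, (c w b : ℤ) * ω w b := Finset.sum_nonneg fun _ _ => by positivity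
      linarith

theorem Feasible.reaches (hω : ∀ u v : V, G.Adj u v → 2 ≤ ω u v) {p : V → ℤ}
    {f : V → V → ℕ} (hp : IsDistrib p) (h : Feasible G ω x p f) : Reaches G ω p x 1 := by
  induction hN : ∑ a, ∑ b, f a b using Nat.strong_induction_on generalizing f p with
  | _ N ih =>
  subst hN
  by_cases hne : ∃ a b, f a b ≠ 0
  swap
  · push Not at hne
    exact ⟨[], trivial, by simpa [balance, hne, applyList] using h.goal⟩
  by_cases hleg : ∃ v u, f v u ≠ 0 ∧ (ω v u : ℤ) ≤ p v
  · obtain ⟨v, u, hvu, hle⟩ := hleg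
    have hadj := h.adj v u hvu
    let g : V → V → ℕ := fun a b => f a b - if a = v ∧ b = u then 1 else 0
    have hfg : f = fun a b => g a b + if a = v ∧ b = u then 1 else 0 := by
      funext a b
      by_cases hab : a = v ∧ b = u
      · obtain ⟨rfl, rfl⟩ := hab
        simp only [g, and_self, if_true]; omega
      · simp [g, hab]
    have hgf : ∀ a b, g a b ≤ f a b := fun a b => Nat.sub_le _ _
    have hbal : ∀ w, balance ω f p w = balance ω g (moveFn ω (v, u) p) w := by
      intro w
      conv_lhs => rw [hfg]
      exact balance_add_move g p hadj.ne w
    have hnn : ∀ w, 0 ≤ moveFn ω (v, u) p w := by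
      intro w
      rw [moveFn_eq p hadj.ne]
      have := hp w
      by_cases hw : w = v
      · subst hw
        simp only [hadj.ne, if_true, if_false]; linarith
      · simp only [hw, if_false]; split_ifs <;> linarith
    have hlt : ∑ a, ∑ b, g a b < ∑ a, ∑ b, f a b := by
      refine Finset.sum_lt_sum (fun a _ => Finset.sum_le_sum fun b _ => hgf a b)
        ⟨v, mem_univ _, Finset.sum_lt_sum (fun b _ => hgf v b) ⟨u, mem_univ _, ?_⟩⟩
      simp only [g, and_self, if_true]; omega
    obtain ⟨l, hl, hx⟩ := ih _ hlt hnn (f := g)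
      ⟨fun a b hab => h.adj a b (by have := hgf a b; omega),
        fun w => hbal w ▸ h.nonneg w, hbal x ▸ h.goal⟩ rfl
    exact ⟨(v, u) :: l, ⟨hadj, hnn, hl⟩, hx⟩
  · push Not at hleg
    have hin : ∀ a b, f a b ≠ 0 → ∃ c, f c a ≠ 0 := by
      intro a b hab
      by_contra! hc
      have h1 := h.nonneg a
      have h2 : (f a b : ℤ) * ω a b ≤ ∑ b, (f a b : ℤ) * ω a b :=
        Finset.single_le_sum (f := fun b => (f a b : ℤ) * ω a b)
          (fun _ _ => by positivity) (mem_univ b)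
      have h3 : (1 : ℤ) ≤ f a b := by exact_mod_cast Nat.one_le_iff_ne_zero.2 hab
      have h4 := hleg a b hab
      simp only [balance, hc, Nat.cast_zero, Finset.sum_const_zero] at h1
      nlinarith
    obtain ⟨g, hgf, hlt, hbal⟩ := exists_smaller_flow hω h.adj hne hin p
    exact ih _ hlt hp ⟨fun a b hab => h.adj a b (by have := hgf a b; omega),
      fun w => (h.nonneg w).trans (hbal w), h.goal.trans (hbal x)⟩ rfl

theorem Reaches.exists_feasible {p : V → ℤ} (hp : IsDistrib p) (h : Reaches G ω p x 1) :
    ∃ f, Feasible G ω x p f := by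
  obtain ⟨l, hl, hx⟩ := h
  obtain ⟨f, hf, hb⟩ := exists_flow_of_executable l p hp hl
  refine ⟨f, hf, fun w => ?_, ?_⟩
  · rw [(hb w).2]; exact (hb w).1
  · rw [(hb x).2]; exact_mod_cast hx

theorem Reaches.mono (hω : ∀ u v : V, G.Adj u v → 2 ≤ ω u v) {p q : V → ℤ}
    (hp : IsDistrib p) (hpq : ∀ v, p v ≤ q v) (h : Reaches G ω p x 1) :
    Reaches G ω q x 1 := by
  obtain ⟨f, hf⟩ := h.exists_feasible hp
  exact Feasible.reaches hω (fun v => (hp v).trans (hpq v)) (f := f)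
    ⟨hf.adj, fun w => (hf.nonneg w).trans (balance_mono_distrib f w (hpq w)),
      hf.goal.trans (balance_mono_distrib f x (hpq x))⟩

end Flow

section Squish

/-- The vertices `u 0, …, u n` form a path of length at least `2` with edges of weight `2`
whose inner vertices have degree `2` and differ from `x`. -/
structure IsSegment (G : SimpleGraph V) (ω : V → V → ℕ) (x : V) (u : ℕ → V) (n : ℕ) :
    Prop where
  two_le : 2 ≤ n
  inj : ∀ s t, s ≤ n → t ≤ n → u s = u t → s = t
  adj : ∀ t < n, G.Adj (u t) (u (t + 1))
  weight : ∀ t < n, ω (u t) (u (t + 1)) = 2 ∧ ω (u (t + 1)) (u t) = 2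
  nbr : ∀ t, t + 1 < n → ∀ b, G.Adj (u (t + 1)) b → b = u t ∨ b = u (t + 2)
  ne_goal : ∀ t, 0 < t → t < n → u t ≠ x

variable {ω : V → V → ℕ} {u : ℕ → V} {n : ℕ}

theorem IsSegment.reverse (h : IsSegment G ω x u n) :
    IsSegment G ω x (fun t => u (n - t)) n where
  two_le := h.two_le
  inj s t hs ht hst := by
    have := h.inj _ _ (Nat.sub_le _ _) (Nat.sub_le _ _) hst
    omega
  adj t ht := by
    have := (h.adj (n - (t + 1)) (by omega)).symm
    rwa [show n - (t + 1) + 1 = n - t by omega] at this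
  weight t ht := by
    have := (h.weight (n - (t + 1)) (by omega)).symm
    rwa [show n - (t + 1) + 1 = n - t by omega] at this
  nbr t ht b hb := by
    have := h.nbr (n - (t + 2)) (by omega) b
      (by rwa [show n - (t + 2) + 1 = n - (t + 1) by omega])
    rw [show n - (t + 2) + 2 = n - t by omega] at this
    exact this.symm
  ne_goal t h0 ht := h.ne_goal _ (by omega) (by omega)

theorem IsSegment.balance_inner [Fintype V] (h : IsSegment G ω x u n) {f : V → V → ℕ}
    (hf : ∀ a b, f a b ≠ 0 → G.Adj a b) (p : V → ℤ) (t : ℕ) (ht : t + 1 < n) :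
    balance ω f p (u (t + 1)) = p (u (t + 1)) + f (u t) (u (t + 1))
      + f (u (t + 2)) (u (t + 1)) - 2 * f (u (t + 1)) (u t)
      - 2 * f (u (t + 1)) (u (t + 2)) := by
  have hne : u t ≠ u (t + 2) := fun e => by
    have := h.inj _ _ (by omega) (by omega) e; omega
  have h0 : ∀ b, b ≠ u t ∧ b ≠ u (t + 2) → ¬ G.Adj (u (t + 1)) b := fun b hb hadj =>
    (h.nbr t ht b hadj).elim hb.1 hb.2
  unfold balance
  rw [Fintype.sum_eq_add (u t) (u (t + 2)) hne, Fintype.sum_eq_add (u t) (u (t + 2)) hne,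
    (h.weight t (by omega)).2, (h.weight (t + 1) ht).1]
  · push_cast; ring
  · intro b hb
    have : f (u (t + 1)) b = 0 := by
      by_contra hc; exact h0 b hb (hf _ _ hc)
    simp [this]
  · intro b hb
    have : f b (u (t + 1)) = 0 := by
      by_contra hc; exact h0 b hb (hf _ _ hc).symm
    simp [this]

variable [DecidableEq V]

/-- The squishing move: the two ends of `u 0, …, u n` each pass one pebble inwards. -/
def squish (u : ℕ → V) (n : ℕ) (p : V → ℤ) (w : V) : ℤ :=
  p w - (if w = u 0 then 1 else 0) - (if w = u n then 1 else 0)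
    + (if w = u 1 then 1 else 0) + (if w = u (n - 1) then 1 else 0)

theorem IsSegment.squish_reverse (h : IsSegment G ω x u n) (p : V → ℤ) :
    squish (fun t => u (n - t)) n p = squish u n p := by
  have := h.two_le
  funext w
  simp only [squish, Nat.sub_zero, Nat.sub_self, show n - (n - 1) = 1 by omega]
  ring

theorem IsSegment.squish_nonneg (h : IsSegment G ω x u n) {p : V → ℤ} (hp : IsDistrib p)
    (h0 : 0 < p (u 0)) (hn : 0 < p (u n)) : IsDistrib (squish u n p) := by
  intro w
  have h2 := h.two_le
  have hw := hp w
  have hne : u 0 ≠ u n := fun e => by have := h.inj 0 n (by omega) le_rfl e; omega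
  unfold squish
  by_cases e0 : w = u 0
  · subst e0
    simp only [hne, if_true, if_false]
    split_ifs <;> linarith
  · by_cases en : w = u n
    · subst en
      simp only [e0, if_true, if_false]
      split_ifs <;> linarith
    · simp only [e0, en, if_false]
      split_ifs <;> linarith

variable [Fintype V]

theorem sum_squish_mul (p φ : V → ℤ) :
    ∑ w, squish u n p w * φ w =
      ∑ w, p w * φ w - φ (u 0) - φ (u n) + φ (u 1) + φ (u (n - 1)) := by
  simp [squish, sub_mul, add_mul, Finset.sum_add_distrib, Finset.sum_sub_distrib]

theorem size_squish (p : V → ℤ) : size (squish u n p) = size p := by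
  have := sum_squish_mul (u := u) (n := n) p (fun _ => 1)
  simp only [mul_one] at this
  unfold size
  linarith

/-- Off the inner vertices of the segment, the loss of a single move into each end is made up
for by undoing the squishing move. -/
theorem balance_squish_le {f g : V → V → ℕ} {p : V → ℤ} {w : V}
    (hw : ∀ t, 0 < t → t < n → w ≠ u t) (hn : 2 ≤ n)
    (hout : ∀ b, g w b ≤ f w b)
    (hin : ∀ a, f a w ≤ g a w + (if a = u 1 ∧ w = u 0 then 1 else 0)
      + (if a = u (n - 1) ∧ w = u n then 1 else 0)) :
    balance ω f (squish u n p) w ≤ balance ω g p w := by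
  have h1 : ∑ b, (g w b : ℤ) * ω w b ≤ ∑ b, (f w b : ℤ) * ω w b :=
    Finset.sum_le_sum fun b _ =>
      mul_le_mul_of_nonneg_right (by exact_mod_cast hout b) (by positivity)
  have h2 : ∑ a, (f a w : ℤ) ≤ ∑ a, (g a w : ℤ) + (if w = u 0 then 1 else 0)
      + (if w = u n then 1 else 0) := by
    have : ∑ a, (f a w : ℤ) ≤ ∑ a, ((g a w : ℤ) + (if a = u 1 ∧ w = u 0 then 1 else 0)
        + (if a = u (n - 1) ∧ w = u n then 1 else 0)) :=
      Finset.sum_le_sum fun a _ => by exact_mod_cast hin a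
    refine this.trans (le_of_eq ?_)
    have hsum : ∀ c d : V, ∑ a, (if a = c ∧ w = d then (1 : ℤ) else 0) =
        if w = d then 1 else 0 := fun c d => by by_cases e : w = d <;> simp [e]
    rw [Finset.sum_add_distrib, Finset.sum_add_distrib, hsum, hsum]
  unfold balance squish
  simp only [hw 1 (by omega) (by omega), hw (n - 1) (by omega) (by omega), if_false]
  linarith

theorem IsSegment.feasible_of_le (h : IsSegment G ω x u n) {f g : V → V → ℕ} {p : V → ℤ}
    (hf : Feasible G ω x (squish u n p) f) (hgf : ∀ a b, g a b ≤ f a b)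
    (hin : ∀ a w, (∀ t, 0 < t → t < n → w ≠ u t) →
      f a w ≤ g a w + (if a = u 1 ∧ w = u 0 then 1 else 0)
        + (if a = u (n - 1) ∧ w = u n then 1 else 0))
    (hinner : ∀ t, t + 1 < n → 0 ≤ balance ω g p (u (t + 1))) :
    Feasible G ω x p g where
  adj a b hab := hf.adj a b (by have := hgf a b; omega)
  nonneg w := by
    by_cases hw : ∀ t, 0 < t → t < n → w ≠ u t
    · exact (hf.nonneg w).trans (balance_squish_le hw h.two_le (hgf w) (hin · w hw))
    · push Not at hw
      obtain ⟨t, h0, ht, rfl⟩ := hw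
      obtain ⟨s, rfl⟩ := Nat.exists_eq_succ_of_ne_zero h0.ne'
      exact hinner s ht
  goal := by
    have hw : ∀ t, 0 < t → t < n → x ≠ u t := fun t h0 ht => (h.ne_goal t h0 ht).symm
    exact hf.goal.trans (balance_squish_le hw h.two_le (hgf x) (hin · x hw))

theorem IsSegment.feasible_inward (h : IsSegment G ω x u n) {f : V → V → ℕ} {p : V → ℤ}
    (hp : IsDistrib p) (hf : Feasible G ω x (squish u n p) f)
    (hl : f (u 1) (u 0) = 0) (hr : f (u (n - 1)) (u n) = 0) :
    ∃ g, Feasible G ω x p g := by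
  classical
  let I : V → Prop := fun a => ∃ t, 0 < t ∧ t < n ∧ a = u t
  let g : V → V → ℕ := fun a b => if I a ∨ I b then 0 else f a b
  have hgf : ∀ a b, g a b ≤ f a b := fun a b => by
    simp only [g]; split_ifs <;> omega
  refine ⟨g, h.feasible_of_le hf hgf (fun a w hw => ?_) (fun t ht => ?_)⟩
  · have hIw : ¬ I w := fun ⟨t, h0, ht, e⟩ => hw t h0 ht e
    by_cases hIa : I a
    · suffices f a w = 0 by omega
      obtain ⟨t, h0, ht, rfl⟩ := hIa
      obtain ⟨s, rfl⟩ := Nat.exists_eq_succ_of_ne_zero h0.ne'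
      by_contra hc
      rcases h.nbr s ht w (hf.adj _ _ hc) with rfl | rfl
      · rcases Nat.eq_zero_or_pos s with rfl | hs
        · exact hc hl
        · exact hw s hs (by omega) rfl
      · rcases Nat.lt_or_ge (s + 2) n with hs | hs
        · exact hw (s + 2) (by omega) hs rfl
        · obtain rfl : n = s + 2 := by omega
          exact hc hr
    · simp only [g, hIw, hIa, or_self, if_false]; omega
  · have hI : I (u (t + 1)) := ⟨t + 1, by omega, ht, rfl⟩
    simpa [balance, g, hI] using hp (u (t + 1))

theorem IsSegment.feasible_outward (h : IsSegment G ω x u n) {f : V → V → ℕ} {p : V → ℤ}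
    (hf : Feasible G ω x (squish u n p) f)
    (hl : f (u 1) (u 0) ≠ 0) (hr : f (u (n - 1)) (u n) ≠ 0) :
    ∃ g, Feasible G ω x p g := by
  have h2 := h.two_le
  have hinj : ∀ s t, s ≤ n → t ≤ n → (u s = u t ↔ s = t) := fun s t hs ht =>
    ⟨h.inj s t hs ht, fun e => e ▸ rfl⟩
  let g : V → V → ℕ := fun a b =>
    f a b - (if a = u 1 ∧ b = u 0 then 1 else 0) - (if a = u (n - 1) ∧ b = u n then 1 else 0)
  have hgf : ∀ a b, g a b ≤ f a b := fun a b => by simp only [g]; omega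
  have hg : ∀ a b, g a b ≠ 0 → G.Adj a b := fun a b hab =>
    hf.adj a b (by have := hgf a b; omega)
  refine ⟨g, h.feasible_of_le hf hgf (fun a w _ => by simp only [g]; omega) (fun t ht => ?_)⟩
  have hb := hf.nonneg (u (t + 1))
  rw [h.balance_inner hf.adj _ t ht] at hb
  rw [h.balance_inner hg _ t ht]
  have e1 : g (u t) (u (t + 1)) = f (u t) (u (t + 1)) := by
    simp only [g, hinj t 1 (by omega) (by omega), hinj (t + 1) 0 (by omega) (by omega),
      hinj (t + 1) n (by omega) (by omega)]
    rw [if_neg (by omega), if_neg (by omega)]; rfl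
  have e2 : g (u (t + 2)) (u (t + 1)) = f (u (t + 2)) (u (t + 1)) := by
    simp only [g, hinj (t + 1) 0 (by omega) (by omega), hinj (t + 1) n (by omega) (by omega)]
    rw [if_neg (by omega), if_neg (by omega)]; rfl
  have e3 : f (u (t + 1)) (u t) = g (u (t + 1)) (u t) + if t = 0 then 1 else 0 := by
    simp only [g, hinj (t + 1) 1 (by omega) (by omega), hinj t 0 (by omega) (by omega),
      hinj t n (by omega) (by omega)]
    rw [if_neg (c := _ ∧ t = n) (by omega)]
    by_cases ht0 : t = 0
    · subst ht0
      simp only [and_self, if_true, zero_add]; omega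
    · simp [ht0]
  have e4 : f (u (t + 1)) (u (t + 2)) =
      g (u (t + 1)) (u (t + 2)) + if t + 2 = n then 1 else 0 := by
    simp only [g, hinj (t + 1) (n - 1) (by omega) (by omega), hinj (t + 2) 0 (by omega) (by omega),
      hinj (t + 2) n (by omega) (by omega)]
    rw [if_neg (c := _ ∧ t + 2 = 0) (by omega)]
    by_cases htn : t + 2 = n
    · have : f (u (t + 1)) (u (t + 2)) ≠ 0 := by
        rw [htn, show t + 1 = n - 1 by omega]; exact hr
      rw [if_pos ⟨by omega, htn⟩, if_pos htn]; omega
    · rw [if_neg (by omega), if_neg htn]; rfl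
  have e5 : squish u n p (u (t + 1)) =
      p (u (t + 1)) + (if t = 0 then 1 else 0) + (if t + 2 = n then 1 else 0) := by
    simp only [squish, hinj (t + 1) 0 (by omega) (by omega), hinj (t + 1) n (by omega) (by omega),
      hinj (t + 1) 1 (by omega) (by omega), hinj (t + 1) (n - 1) (by omega) (by omega)]
    rw [if_neg (by omega), if_neg (by omega)]
    split_ifs <;> omega
  rw [e3, e4, e5] at hb
  rw [e1, e2]
  split_ifs at hb <;> push_cast at hb <;> linarith

theorem IsSegment.feasible_rightward (h : IsSegment G ω x u n) {f : V → V → ℕ} {p : V → ℤ}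
    (hp : IsDistrib p) (hf : Feasible G ω x (squish u n p) f)
    (hcan : ∀ a b, f a b = 0 ∨ f b a = 0)
    (hl : f (u 1) (u 0) = 0) (hr : f (u (n - 1)) (u n) ≠ 0) :
    ∃ g, Feasible G ω x p g := by
  classical
  have h2 := h.two_le
  have hinj : ∀ s t, s ≤ n → t ≤ n → (u s = u t ↔ s = t) := fun s t hs ht =>
    ⟨h.inj s t hs ht, fun e => e ▸ rfl⟩
  let R : V → V → Prop := fun a b => ∃ t, 0 < t ∧ t < n ∧ a = u t ∧ b = u (t + 1)
  let g : V → V → ℕ := fun a b => f a b - (if R a b then 1 else 0)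
  have hgf : ∀ a b, g a b ≤ f a b := fun a b => by simp only [g]; omega
  have hg : ∀ a b, g a b ≠ 0 → G.Adj a b := fun a b hab =>
    hf.adj a b (by have := hgf a b; omega)
  have hR : ∀ s t, s ≤ n → t ≤ n → (R (u s) (u t) ↔ 0 < s ∧ t = s + 1) := by
    intro s t hs ht
    constructor
    · rintro ⟨r, h0, hr, e1, e2⟩
      have := h.inj _ _ hs (by omega) e1
      have := h.inj _ _ ht (by omega) e2
      omega
    · rintro ⟨h0, rfl⟩
      exact ⟨s, h0, by omega, rfl, rfl⟩
  refine ⟨g, h.feasible_of_le hf hgf (fun a w hw => ?_) (fun t ht => ?_)⟩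
  · by_cases hRw : R a w
    · obtain ⟨t, h0, ht, rfl, rfl⟩ := hRw
      have : t + 1 = n := by
        by_contra hc
        exact hw (t + 1) (by omega) (by omega) rfl
      rw [if_pos (c := u t = u (n - 1) ∧ _) ⟨by rw [← this]; rfl, by rw [this]⟩]
      simp only [g]; split_ifs <;> omega
    · simp only [g, hRw, if_false]; omega
  have hb := hf.nonneg (u (t + 1))
  rw [h.balance_inner hf.adj _ t ht] at hb
  rw [h.balance_inner hg _ t ht]
  have e1 : g (u t) (u (t + 1)) = f (u t) (u (t + 1)) - if 0 < t then 1 else 0 := by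
    simp [g, hR t (t + 1) (by omega) (by omega)]
  have e2 : g (u (t + 2)) (u (t + 1)) = f (u (t + 2)) (u (t + 1)) := by
    simp [g, hR (t + 2) (t + 1) (by omega) (by omega)]
  have e3 : g (u (t + 1)) (u t) = f (u (t + 1)) (u t) := by
    simp only [g, hR (t + 1) t (by omega) (by omega)]
    rw [if_neg (by omega)]; rfl
  have e4 : g (u (t + 1)) (u (t + 2)) = f (u (t + 1)) (u (t + 2)) - 1 := by
    simp [g, hR (t + 1) (t + 2) (by omega) (by omega)]
  have e5 : squish u n p (u (t + 1)) =
      p (u (t + 1)) + (if t = 0 then 1 else 0) + (if t + 2 = n then 1 else 0) := by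
    simp only [squish, hinj (t + 1) 0 (by omega) (by omega), hinj (t + 1) n (by omega) (by omega),
      hinj (t + 1) 1 (by omega) (by omega), hinj (t + 1) (n - 1) (by omega) (by omega)]
    rw [if_neg (by omega), if_neg (by omega)]
    split_ifs <;> omega
  have hpt := hp (u (t + 1))
  have hc := hcan (u t) (u (t + 1))
  have hl' : t = 0 → f (u (t + 1)) (u t) = 0 := by rintro rfl; exact hl
  have hr' : t + 2 = n → f (u (t + 1)) (u (t + 2)) ≠ 0 := by
    rintro rfl; exact hr
  rw [e5] at hb
  rw [e1, e2, e3, e4]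
  split_ifs at hb ⊢ <;> omega

theorem IsSegment.reaches_of_squish (h : IsSegment G ω x u n)
    (hω : ∀ u v : V, G.Adj u v → 2 ≤ ω u v) {p : V → ℤ} (hp : IsDistrib p)
    (hs : IsDistrib (squish u n p)) (hr : Reaches G ω (squish u n p) x 1) :
    Reaches G ω p x 1 := by
  obtain ⟨f₀, hf₀⟩ := hr.exists_feasible hs
  have hf := hf₀.cancel hω
  have hcan : ∀ a b, f₀ a b - f₀ b a = 0 ∨ f₀ b a - f₀ a b = 0 := fun a b => by omega
  suffices ∃ g, Feasible G ω x p g from this.elim fun g hg => hg.reaches hω hp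
  by_cases hl : f₀ (u 1) (u 0) - f₀ (u 0) (u 1) = 0 <;>
    by_cases hr : f₀ (u (n - 1)) (u n) - f₀ (u n) (u (n - 1)) = 0
  · exact h.feasible_inward hp hf hl hr
  · exact h.feasible_rightward hp hf hcan hl hr
  · have h2 := h.two_le
    have hrev := h.reverse
    rw [← h.squish_reverse p] at hf
    refine hrev.feasible_rightward hp hf hcan (by simpa using hr) ?_
    simpa [show n - (n - 1) = 1 by omega] using hl
  · exact h.feasible_outward hf hl hr

end Squish

section Potential

/-- A vertex function that is strictly convex at every vertex of degree `2` other than `x`. -/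
theorem exists_convex_potential [Fintype V] (hG : G.Connected) (x : V) :
    ∃ φ : V → ℤ, (∀ v, 0 ≤ φ v) ∧ ∀ v a b, v ≠ x → G.Adj v a → G.Adj v b →
      (∀ c, G.Adj v c → c = a ∨ c = b) → 2 * φ v < φ a + φ b := by
  have hle : ∀ v, G.dist v x ≤ ∑ w, G.dist w x := fun v =>
    Finset.single_le_sum (f := fun w => G.dist w x) (fun _ _ => Nat.zero_le _) (mem_univ v)
  set N := ∑ w, G.dist w x
  let φ : V → ℤ := fun v => 3 ^ (N - G.dist v x)
  have hpos : ∀ v, 0 < φ v := fun v => by positivity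
  refine ⟨φ, fun v => (hpos v).le, fun v a b hv _ _ hab => ?_⟩
  obtain ⟨W, hW⟩ := (hG.preconnected v x).exists_walk_length_eq_dist
  cases W with
  | nil => exact absurd rfl hv
  | @cons _ c _ hc W =>
    have h1 : G.dist c x + 1 ≤ G.dist v x := by
      rw [← hW, SimpleGraph.Walk.length_cons]
      exact Nat.succ_le_succ (SimpleGraph.dist_le W)
    have h2 : 3 * φ v ≤ φ c := by
      have := hle v
      simp only [φ]
      rw [← pow_succ']
      exact pow_le_pow_right₀ (by norm_num) (by omega)
    have hva := hpos a
    have hvb := hpos b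
    have hvv := hpos v
    rcases hab c hc with rfl | rfl <;> linarith

variable {ω : V → V → ℕ} {u : ℕ → V} {n : ℕ}

theorem IsSegment.potential_lt (h : IsSegment G ω x u n) {φ : V → ℤ}
    (hφ : ∀ v a b, v ≠ x → G.Adj v a → G.Adj v b →
      (∀ c, G.Adj v c → c = a ∨ c = b) → 2 * φ v < φ a + φ b) :
    φ (u 1) + φ (u (n - 1)) < φ (u 0) + φ (u n) := by
  have hconv : ∀ t, t + 1 < n → 2 * φ (u (t + 1)) < φ (u t) + φ (u (t + 2)) := fun t ht =>
    hφ _ _ _ (h.ne_goal _ (by omega) ht) (h.adj t (by omega)).symm (h.adj (t + 1) ht)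
      (h.nbr t ht)
  have key : ∀ t, t + 1 < n → φ (u 1) - φ (u 0) < φ (u (t + 2)) - φ (u (t + 1)) := by
    intro t
    induction t with
    | zero => intro ht; have := hconv 0 ht; simp only [zero_add] at *; linarith
    | succ t ih =>
      intro ht
      have := ih (by omega)
      have := hconv (t + 1) ht
      linarith
  obtain ⟨m, rfl⟩ := Nat.exists_eq_add_of_le' h.two_le
  have := key m (by omega)
  rw [show m + 2 - 1 = m + 1 by omega]
  linarith

end Potential

theorem EarData.exists_segment {ω : V → V → ℕ} (hsym : ∀ u v : V, ω u v = ω v u)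
    (E : EarData G x) (hE : E.Unweighted ω) {p : V → ℤ} (hns : ¬ E.SquishedOn p) :
    ∃ (u : ℕ → V) (n : ℕ), IsSegment G ω x u n ∧ 0 < p (u 0) ∧ 0 < p (u n) := by
  classical
  let P : ℕ → Prop := fun i => 0 < i ∧ ∃ h : i < E.k + 1, 0 < p (E.w ⟨i, by omega⟩)
  have hinner : ∀ i : Fin (E.k + 2), i ≠ 0 → i ≠ Fin.last (E.k + 1) → 0 < p (E.w i) →
      P i := by
    intro i h0 hl hi
    have h1 : (i : ℕ) ≠ 0 := fun e => h0 (Fin.ext e)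
    have h2 : (i : ℕ) ≠ E.k + 1 := fun e => hl (Fin.ext e)
    exact ⟨by omega, by have := i.2; omega, hi⟩
  have hex : ∃ i, P i := by
    by_contra! hc
    exact hns ⟨0, fun i h0 hl hi => absurd (hinner i h0 hl hi) (hc i)⟩
  obtain ⟨hi0, hi1, hip⟩ := Nat.find_spec hex
  have hmin : ∀ j, P j → Nat.find hex ≤ j := fun j hj => Nat.find_min' hex hj
  generalize Nat.find hex = i at *
  have hj : ∃ j, P j ∧ i + 2 ≤ j := by
    by_contra! hc
    refine hns ⟨⟨i, by omega⟩, fun j h0 hl hj => ?_⟩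
    have h1 := hinner j h0 hl hj
    have h2 := hmin j h1
    have h3 := hc j h1
    rcases Nat.lt_or_ge i j with h | h
    · right; simp only; omega
    · left; exact Fin.ext (by simp only; omega)
  obtain ⟨j, ⟨hj0, hj1, hjp⟩, hij⟩ := hj
  let u : ℕ → V := fun t => E.w (Fin.ofNat (E.k + 2) (i + t))
  have hu : ∀ t (ht : i + t < E.k + 2), u t = E.w ⟨i + t, ht⟩ := fun t ht => by
    simp only [u]; congr 1; exact Fin.ext (Nat.mod_eq_of_lt ht)
  have hin0 : ∀ t (ht : i + t < E.k + 1), (⟨i + t, by omega⟩ : Fin (E.k + 2)) ≠ 0 :=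
    fun t ht e => by have := congrArg Fin.val e; simp at this; omega
  have hinl : ∀ t (ht : i + t < E.k + 1),
      (⟨i + t, by omega⟩ : Fin (E.k + 2)) ≠ Fin.last (E.k + 1) :=
    fun t ht e => by have := congrArg Fin.val e; simp at this; omega
  refine ⟨u, j - i, ⟨by omega, ?_, ?_, ?_, ?_, ?_⟩, ?_, ?_⟩
  · intro s t hs ht e
    rw [hu s (by omega), hu t (by omega)] at e
    have := E.inj _ _ (hin0 s (by omega)) (hinl s (by omega)) e
    simp only [Fin.mk.injEq] at this
    omega
  · intro t ht
    rw [hu t (by omega), hu (t + 1) (by omega)]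
    exact E.adj ⟨i + t, by omega⟩
  · intro t ht
    rw [hu t (by omega), hu (t + 1) (by omega)]
    have := hE ⟨i + t, by omega⟩
    exact ⟨this, (hsym _ _).trans this⟩
  · intro t ht b hb
    rw [hu (t + 1) (by omega)] at hb
    rw [hu t (by omega), hu (t + 2) (by omega)]
    have hb' : b ∈ G.neighborSet _ := hb
    rw [E.deg2 _ (hin0 (t + 1) (by omega)) (hinl (t + 1) (by omega))] at hb'
    have e1 : (⟨i + (t + 1), by omega⟩ : Fin (E.k + 2)) - 1 = ⟨i + t, by omega⟩ := by
      rw [sub_eq_iff_eq_add]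
      apply Fin.ext
      rw [Fin.val_add]
      simp only [Fin.val_one]
      rw [Nat.mod_eq_of_lt (by omega)]; omega
    have e2 : (⟨i + (t + 1), by omega⟩ : Fin (E.k + 2)) + 1 = ⟨i + (t + 2), by omega⟩ := by
      apply Fin.ext
      rw [Fin.val_add]
      simp only [Fin.val_one]
      rw [Nat.mod_eq_of_lt (by omega)]; omega
    rw [e1, e2] at hb'
    simpa using hb'
  · intro t _ ht
    rw [hu t (by omega)]
    exact E.notx _ (hin0 t (by omega)) (hinl t (by omega))
  · rw [hu 0 (by omega)]; exact hip
  · rw [hu (j - i) (by omega)]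
    have : (⟨i + (j - i), by omega⟩ : Fin (E.k + 2)) = ⟨j, by omega⟩ := Fin.ext (by simp only; omega)
    rw [this]; exact hjp

/-- An insufficient distribution can be squished on all unweighted ears simultaneously. -/
theorem exists_squished [Fintype V] [DecidableEq V] (hG : G.Connected) {ω : V → V → ℕ}
    (hsym : ∀ u v : V, ω u v = ω v u) (hω : ∀ u v : V, G.Adj u v → 2 ≤ ω u v)
    {p : V → ℤ} (hp : IsDistrib p) (hr : ¬ Reaches G ω p x 1) :
    ∃ q : V → ℤ, IsDistrib q ∧ ¬ Reaches G ω q x 1 ∧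
      (∀ E : EarData G x, E.Unweighted ω → E.SquishedOn q) ∧ size q = size p := by
  obtain ⟨φ, hφ0, hφ⟩ := exists_convex_potential hG x
  induction hN : (∑ v, p v * φ v).toNat using Nat.strong_induction_on generalizing p with
  | _ N ih =>
  by_cases hsq : ∀ E : EarData G x, E.Unweighted ω → E.SquishedOn p
  · exact ⟨p, hp, hr, hsq, rfl⟩
  push Not at hsq
  obtain ⟨E, hE, hns⟩ := hsq
  obtain ⟨u, n, hseg, h0, hn⟩ := E.exists_segment hsym hE hns
  have hs := hseg.squish_nonneg hp h0 hn
  have hlt : (∑ v, squish u n p v * φ v).toNat < N := by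
    have h1 := sum_squish_mul (u := u) (n := n) p φ
    have h2 := hseg.potential_lt hφ
    have h3 : 0 ≤ ∑ v, squish u n p v * φ v :=
      Finset.sum_nonneg fun v _ => mul_nonneg (hs v) (hφ0 v)
    omega
  obtain ⟨q, hq, hqr, hqs, hqz⟩ :=
    ih _ hlt hs (fun h => hr (hseg.reaches_of_squish hω hp hs h)) rfl
  exact ⟨q, hq, hqr, hqs, hqz.trans (size_squish p)⟩

theorem exists_reaches_bound_of_walk [Fintype V] [DecidableEq V] {ω : V → V → ℕ}
    (hω : ∀ u v : V, G.Adj u v → 2 ≤ ω u v) {v : V} (W : G.Walk v x) :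
    ∃ C : ℕ, ∀ p : V → ℤ, IsDistrib p → (C : ℤ) ≤ p v → Reaches G ω p x 1 := by
  induction W with
  | nil => exact ⟨1, fun p _ h => ⟨[], trivial, h⟩⟩
  | @cons v v' x hadj W ih =>
    obtain ⟨C, hC⟩ := ih
    refine ⟨C * ω v v', fun p hp h => ?_⟩
    let q : V → ℤ := fun w =>
      p w + (if w = v' then (C : ℤ) else 0) - (if w = v then (C : ℤ) * ω v v' else 0)
    have hq : IsDistrib q := by
      intro w
      have := hp w
      simp only [q]
      push_cast at h
      by_cases hw : w = v
      · subst hw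
        simp only [hadj.ne, if_true, if_false]; linarith
      · simp only [hw, if_false]; split_ifs <;> linarith [Int.natCast_nonneg C]
    have hqC : (C : ℤ) ≤ q v' := by
      have := hp v'
      simp only [q, hadj.ne', if_true, if_false]; linarith
    obtain ⟨f, hf⟩ := (hC q hq hqC).exists_feasible hq
    have hbal : ∀ w, balance ω (fun a b => f a b + if a = v ∧ b = v' then C else 0) p w =
        balance ω f q w := by
      intro w
      rw [balance_add_single]
      simp only [balance, q]
      ring
    refine Feasible.reaches hω hp (f := fun a b => f a b + if a = v ∧ b = v' then C else 0)
      ⟨fun a b hab => ?_, fun w => (hbal w).symm ▸ hf.nonneg w, (hbal x).symm ▸ hf.goal⟩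
    by_cases hvv : a = v ∧ b = v'
    · rw [hvv.1, hvv.2]; exact hadj
    · exact hf.adj a b (by simpa [hvv] using hab)

theorem exists_size_bound [Fintype V] [DecidableEq V] (hG : G.Connected) {ω : V → V → ℕ}
    (hω : ∀ u v : V, G.Adj u v → 2 ≤ ω u v) (x : V) :
    ∃ N : ℕ, ∀ p : V → ℤ, IsDistrib p → ¬ Reaches G ω p x 1 → size p ≤ N := by
  have h : ∀ v, ∃ C : ℕ, ∀ p : V → ℤ, IsDistrib p → (C : ℤ) ≤ p v → Reaches G ω p x 1 :=
    fun v => (hG.preconnected v x).elim (exists_reaches_bound_of_walk hω)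
  choose C hC using h
  refine ⟨∑ v, C v, fun p hp hr => ?_⟩
  push_cast
  refine Finset.sum_le_sum fun v _ => ?_
  by_contra! hlt
  exact hr (hC v p hp hlt.le)

theorem not_reaches_zero [Fintype V] [DecidableEq V] {ω : V → V → ℕ}
    (hω : ∀ u v : V, G.Adj u v → 2 ≤ ω u v) : ¬ Reaches G ω (fun _ => 0) x 1 := by
  rintro ⟨_ | ⟨m, l⟩, hl, hx⟩
  · simp [applyList] at hx
  · have h1 := hl.2.1 m.1
    have h2 := hω _ _ hl.1
    simp only [moveFn, if_true] at h1
    omega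

theorem exists_le_size_eq [Fintype V] [DecidableEq V] {p : V → ℤ} (hp : IsDistrib p)
    (m : ℕ) (hm : (m : ℤ) ≤ size p) :
    ∃ q : V → ℤ, IsDistrib q ∧ (∀ v, q v ≤ p v) ∧ size q = m := by
  induction hk : (size p - m).toNat generalizing p with
  | zero => exact ⟨p, hp, fun _ => le_rfl, by omega⟩
  | succ k ih =>
    have hpos : ∃ v, 0 < p v := by
      by_contra! hc
      have : size p ≤ 0 := Finset.sum_nonpos fun v _ => hc v
      omega
    obtain ⟨v, hv⟩ := hpos
    let q : V → ℤ := fun w => p w - if w = v then 1 else 0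
    have hsz : size q = size p - 1 := by
      simp [size, q, Finset.sum_sub_distrib]
    obtain ⟨r, hr, hrq, hrm⟩ := ih (p := q) (fun w => by
      have := hp w
      simp only [q]
      split_ifs with h
      · subst h; omega
      · omega) (by omega) (by omega)
    refine ⟨r, hr, fun w => (hrq w).trans ?_, hrm⟩
    simp only [q]; split_ifs <;> omega

/-- The pebbling number `π(G_ω, x)` equals one plus the maximum size of
a pebble distribution that is insufficient for `x` and squished on the thread of every
unweighted open ear of `G` with respect to `x`. -/
theorem statement17 {V : Type*} [Fintype V] [DecidableEq V]
    (G : SimpleGraph V) (hG : G.Connected)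
    (ω : V → V → ℕ) (hsym : ∀ u v : V, ω u v = ω v u)
    (hω : ∀ u v : V, G.Adj u v → 2 ≤ ω u v) (x : V) :
    piT G ω x 1 =
      1 + sSup {n : ℕ | ∃ p : V → ℤ, IsDistrib p ∧ ¬Reaches G ω p x 1 ∧
        (∀ E : EarData G x, E.IsOpen → E.Unweighted ω → E.SquishedOn p) ∧
        size p = (n : ℤ)} := by
  set T : Set ℕ := {n : ℕ | ∃ p : V → ℤ, IsDistrib p ∧ ¬Reaches G ω p x 1 ∧
    (∀ E : EarData G x, E.IsOpen → E.Unweighted ω → E.SquishedOn p) ∧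
    size p = (n : ℤ)} with hT
  have hmem : ∀ (n : ℕ) (p : V → ℤ), IsDistrib p → ¬Reaches G ω p x 1 → size p = (n : ℤ) →
      n ∈ T := by
    intro n p hp hr hs
    obtain ⟨q, hq, hqr, hqs, hqz⟩ := exists_squished hG hsym hω hp hr
    exact ⟨q, hq, hqr, fun E _ hE => hqs E hE, hqz.trans hs⟩
  have hne : T.Nonempty :=
    ⟨0, hmem 0 (fun _ => 0) (fun _ => le_rfl) (not_reaches_zero hω) (by simp [size])⟩
  have hbdd : BddAbove T := by
    obtain ⟨N, hN⟩ := exists_size_bound hG hω x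
    refine ⟨N, ?_⟩
    rintro n ⟨p, hp, hr, -, hs⟩
    have := hN p hp hr
    omega
  obtain ⟨p, hp, hr, -, hs⟩ := Nat.sSup_mem hne hbdd
  have hub : ∀ n ∈ T, n ≤ sSup T := fun n hn => le_csSup hbdd hn
  refine le_antisymm (Nat.sInf_le ?_) (le_csInf ⟨1 + sSup T, ?_⟩ ?_)
  iterate 2
    intro q hq hqs
    by_contra hqr
    have := hub _ (hmem _ q hq hqr hqs)
    omega
  · intro m hm
    by_contra! hlt
    obtain ⟨q, hq, hqp, hqs⟩ := exists_le_size_eq hp m (by omega)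
    exact hr ((hm q hq hqs).mono hω hq hqp)
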